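/- For every ordering ξ of the Pascal graph, the 3-coding is faithful on X ∖ X'_ξ: if γ and γ' are distinct paths in X ∖ X'_ξ, then ω_3(γ) ≠ ω_3(γ'). -/

import Mathlib

/-- Vertex reached after `n` moves: (number of `false` moves, number of `true` moves). -/
def vertexAt (γ : ℕ → Bool) (n : ℕ) : ℕ × ℕ :=
  (((Finset.range n).filter fun i => γ i = false).card,
   ((Finset.range n).filter fun i => γ i = true).card)

def childOf (v : ℕ × ℕ) (m : Bool) : ℕ × ℕ :=
  if m then (v.1, v.2 + 1) else (v.1 + 1, v.2)

def MoveMin (ξ : ℕ × ℕ → Bool) (v : ℕ × ℕ) (m : Bool) : Prop :=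
  (childOf v m).1 = 0 ∨ (childOf v m).2 = 0 ∨ m = !ξ (childOf v m)

def MoveMax (ξ : ℕ × ℕ → Bool) (v : ℕ × ℕ) (m : Bool) : Prop :=
  (childOf v m).1 = 0 ∨ (childOf v m).2 = 0 ∨ m = ξ (childOf v m)

def IsMinEdge (ξ : ℕ × ℕ → Bool) (γ : ℕ → Bool) (i : ℕ) : Prop :=
  MoveMin ξ (vertexAt γ i) (γ i)

def IsMaxEdge (ξ : ℕ × ℕ → Bool) (γ : ℕ → Bool) (i : ℕ) : Prop :=
  MoveMax ξ (vertexAt γ i) (γ i)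

def XMin (ξ : ℕ × ℕ → Bool) : Set (ℕ → Bool) := {γ | ∀ i, IsMinEdge ξ γ i}

def XMax (ξ : ℕ × ℕ → Bool) : Set (ℕ → Bool) := {γ | ∀ i, IsMaxEdge ξ γ i}

def XPrime (ξ : ℕ × ℕ → Bool) : Set (ℕ → Bool) :=
  {γ | ∃ δ ∈ XMin ξ ∪ XMax ξ, ∃ N : ℕ, ∀ n, N ≤ n → γ n = δ n}

/-- The all-ξ-minimal finite path (list of moves) from the root to a vertex. -/
def minPath (ξ : ℕ × ℕ → Bool) : ℕ × ℕ → List Bool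
  | (0, 0) => []
  | (x + 1, 0) => minPath ξ (x, 0) ++ [false]
  | (0, y + 1) => minPath ξ (0, y) ++ [true]
  | (x + 1, y + 1) =>
      if ξ (x + 1, y + 1) then minPath ξ (x, y + 1) ++ [false]
      else minPath ξ (x + 1, y) ++ [true]
  termination_by p => p.1 + p.2

/-- The all-ξ-maximal finite path (list of moves) from the root to a vertex. -/
def maxPath (ξ : ℕ × ℕ → Bool) : ℕ × ℕ → List Bool
  | (0, 0) => []
  | (x + 1, 0) => maxPath ξ (x, 0) ++ [false]
  | (0, y + 1) => maxPath ξ (0, y) ++ [true]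
  | (x + 1, y + 1) =>
      if ξ (x + 1, y + 1) then maxPath ξ (x + 1, y) ++ [true]
      else maxPath ξ (x, y + 1) ++ [false]
  termination_by p => p.1 + p.2

open Classical in
/-- The adic (Vershik) transformation determined by ξ (identity where undefined). -/
noncomputable def adicT (ξ : ℕ × ℕ → Bool) (γ : ℕ → Bool) : ℕ → Bool :=
  if h : ∃ i, ¬ IsMaxEdge ξ γ i then
    let i0 := Nat.find h
    let v := vertexAt γ (i0 + 1)
    let src : ℕ × ℕ := if ξ v then (v.1, v.2 - 1) else (v.1 - 1, v.2)
    fun n =>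
      if n < i0 then (minPath ξ src).getD n false
      else if n = i0 then ξ v
      else γ n
  else γ

open Classical in
/-- The inverse adic transformation determined by ξ (identity where undefined). -/
noncomputable def adicTInv (ξ : ℕ × ℕ → Bool) (γ : ℕ → Bool) : ℕ → Bool :=
  if h : ∃ i, ¬ IsMinEdge ξ γ i then
    let i0 := Nat.find h
    let v := vertexAt γ (i0 + 1)
    let src : ℕ × ℕ := if ξ v then (v.1 - 1, v.2) else (v.1, v.2 - 1)
    fun n =>
      if n < i0 then (maxPath ξ src).getD n false
      else if n = i0 then !ξ v
      else γ n
  else γ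

/-- ℤ-iterates of the adic transformation. -/
noncomputable def adicIter (ξ : ℕ × ℕ → Bool) : ℤ → (ℕ → Bool) → (ℕ → Bool)
  | Int.ofNat n, γ => (adicT ξ)^[n] γ
  | Int.negSucc n, γ => (adicTInv ξ)^[n + 1] γ

/-- The k-coding of the orbit of γ: symbols are the initial segments of length k. -/
noncomputable def omegaCode (ξ : ℕ × ℕ → Bool) (k : ℕ) (γ : ℕ → Bool) : ℤ → List Bool :=
  fun t => (List.range k).map (adicIter ξ t γ)

/-- Ordered list of all initial segments from the root to (x,y), in increasing ξ-order. -/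
def segList (ξ : ℕ × ℕ → Bool) : ℕ × ℕ → List (List Bool)
  | (0, 0) => [[]]
  | (x + 1, 0) => (segList ξ (x, 0)).map (· ++ [false])
  | (0, y + 1) => (segList ξ (0, y)).map (· ++ [true])
  | (x + 1, y + 1) =>
      if ξ (x + 1, y + 1) then
        (segList ξ (x, y + 1)).map (· ++ [false]) ++ (segList ξ (x + 1, y)).map (· ++ [true])
      else
        (segList ξ (x + 1, y)).map (· ++ [true]) ++ (segList ξ (x, y + 1)).map (· ++ [false])
  termination_by p => p.1 + p.2

/-- Level-k coded basic block at a vertex (x,y) with x+y ≥ k, a word over the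
alphabet of initial segments of length k. -/
def codedBlock (ξ : ℕ × ℕ → Bool) (k : ℕ) : ℕ × ℕ → List (List Bool)
  | (0, 0) => segList ξ (0, 0)
  | (x + 1, 0) => if x + 1 ≤ k then segList ξ (x + 1, 0) else [List.replicate k false]
  | (0, y + 1) => if y + 1 ≤ k then segList ξ (0, y + 1) else [List.replicate k true]
  | (x + 1, y + 1) =>
      if x + 1 + (y + 1) ≤ k then segList ξ (x + 1, y + 1)
      else if ξ (x + 1, y + 1) then codedBlock ξ k (x, y + 1) ++ codedBlock ξ k (x + 1, y)
      else codedBlock ξ k (x + 1, y) ++ codedBlock ξ k (x, y + 1)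
  termination_by p => p.1 + p.2

/-- Basic block over the alphabet {a,b}, with a = `false` and b = `true`. -/
def basicBlock (ξ : ℕ × ℕ → Bool) : ℕ × ℕ → List Bool
  | (0, 0) => []
  | (_ + 1, 0) => [false]
  | (0, _ + 1) => [true]
  | (x + 1, y + 1) =>
      if ξ (x + 1, y + 1) then basicBlock ξ (x, y + 1) ++ basicBlock ξ (x + 1, y)
      else basicBlock ξ (x + 1, y) ++ basicBlock ξ (x, y + 1)
  termination_by p => p.1 + p.2

/-- The finite word ω_s ω_{s+1} ... ω_{t-1}. -/
def wordAt (ω : ℤ → List Bool) (s t : ℤ) : List (List Bool) :=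
  (List.range (t - s).toNat).map fun u => ω (s + u)

/-- A ξ-consistent factoring scheme for ω ∈ 𝒫_k^ℤ: `cuts j` is the set of starting
positions of the blocks of the level-(k+j) factorization, and `vert j s` is the
vertex whose coded basic block is the block starting at the cut `s`. -/
def IsConsistentScheme (ξ : ℕ × ℕ → Bool) (k : ℕ) (ω : ℤ → List Bool)
    (cuts : ℕ → Set ℤ) (vert : ℕ → ℤ → ℕ × ℕ) : Prop :=
  (∀ j : ℕ, ∀ M : ℤ, ∃ s ∈ cuts j, s < M) ∧
  (∀ j : ℕ, ∀ M : ℤ, ∃ t ∈ cuts j, M < t) ∧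
  (∀ j : ℕ, ∀ s ∈ cuts j, ∀ t ∈ cuts j, s < t → (∀ u ∈ cuts j, ¬(s < u ∧ u < t)) →
      (vert j s).1 + (vert j s).2 = k + j ∧
      wordAt ω s t = codedBlock ξ k (vert j s)) ∧
  (∀ j : ℕ, cuts (j + 1) ⊆ cuts j) ∧
  (∀ j : ℕ, ∀ s ∈ cuts (j + 1), ∀ t ∈ cuts (j + 1), s < t →
      (∀ u ∈ cuts (j + 1), ¬(s < u ∧ u < t)) →
      ∀ x y : ℕ, vert (j + 1) s = (x + 1, y + 1) →
        ∃ m ∈ cuts j, s < m ∧ m < t ∧ (∀ u ∈ cuts j, s < u → u < t → u = m) ∧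
          (if ξ (x + 1, y + 1)
            then vert j s = (x, y + 1) ∧ vert j m = (x + 1, y)
            else vert j s = (x + 1, y) ∧ vert j m = (x, y + 1)))

/-- The natural factoring scheme of the k-coding of γ: a level-(k+j) block begins at
coordinate t exactly when T^t γ begins with an all-ξ-minimal path to its level-(k+j) vertex. -/
noncomputable def natCuts (ξ : ℕ × ℕ → Bool) (k : ℕ) (γ : ℕ → Bool) : ℕ → Set ℤ :=
  fun j => {t | ∀ i < k + j, IsMinEdge ξ (adicIter ξ t γ) i}

noncomputable def natVert (ξ : ℕ × ℕ → Bool) (k : ℕ) (γ : ℕ → Bool) : ℕ → ℤ → ℕ × ℕ :=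
  fun j t => vertexAt (adicIter ξ t γ) (k + j)

open Classical in
/-- The return time r_n of the Kink Lemma, where `g` is the move of γ leaving (i,j). -/
noncomputable def kinkReturn (ξ : ℕ × ℕ → Bool) (i j : ℕ) (g : Bool) : ℕ :=
  let n := i + j
  if MoveMax ξ (i, j) g ∧ MoveMin ξ (i, j) (!g) then n.choose j
  else if (MoveMin ξ (i, j) g ∧ MoveMin ξ (i, j) (!g) ∧ g = true) ∨
          (MoveMax ξ (i, j) g ∧ MoveMax ξ (i, j) (!g) ∧ g = false) then (n + 1).choose (j + 1)
  else if (MoveMin ξ (i, j) g ∧ MoveMin ξ (i, j) (!g) ∧ g = false) ∨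
          (MoveMax ξ (i, j) g ∧ MoveMax ξ (i, j) (!g) ∧ g = true) then (n + 1).choose j
  else (n + 1).choose j + n.choose (j + 1)

/-- Convert a length-k list of moves to a function `Fin k → Bool`. -/
def segFn (k : ℕ) (w : List Bool) : Fin k → Bool := fun idx => w.getD idx false

/-- The subshift Σ_k of the k-codings: sequences all of whose finite subblocks occur
in some level-k coded basic block. -/
def SigmaK (ξ : ℕ × ℕ → Bool) (k : ℕ) : Set (ℤ → (Fin k → Bool)) :=
  {ω | ∀ (s : ℤ) (l : ℕ), ∃ p : ℕ × ℕ,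
    ((List.range l).map fun u => ω (s + u)) <:+: (codedBlock ξ k p).map (segFn k)}

/-- The subshift Σ_ξ ⊆ {a,b}^ℤ of sequences all of whose finite subblocks occur in
some basic block B_ξ(x,y). -/
def SigmaXi (ξ : ℕ × ℕ → Bool) : Set (ℤ → Bool) :=
  {ω | ∀ (s : ℤ) (l : ℕ), ∃ p : ℕ × ℕ,
    ((List.range l).map fun u => ω (s + u)) <:+: basicBlock ξ p}

/-- The big subshift Σ: sequences all of whose finite subblocks occur in some basic
block B_ξ(x,y) for some ordering ξ. -/
def BigShift : Set (ℤ → Bool) :=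
  {ω | ∀ (s : ℤ) (l : ℕ), ∃ (ξ : ℕ × ℕ → Bool) (p : ℕ × ℕ),
    ((List.range l).map fun u => ω (s + u)) <:+: basicBlock ξ p}

theorem vertexAt_succ (γ : ℕ → Bool) (n : ℕ) :
    vertexAt γ (n + 1) = childOf (vertexAt γ n) (γ n) := by
  cases h : γ n <;> simp [vertexAt, childOf, Finset.range_add_one, Finset.filter_insert, h]

theorem vertexAt_zero (γ : ℕ → Bool) : vertexAt γ 0 = (0, 0) := by
  simp [vertexAt]

theorem childOf_sum (v : ℕ × ℕ) (m : Bool) :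
    (childOf v m).1 + (childOf v m).2 = v.1 + v.2 + 1 := by
  cases m <;> simp [childOf] <;> omega

theorem vertexAt_sum (γ : ℕ → Bool) (n : ℕ) :
    (vertexAt γ n).1 + (vertexAt γ n).2 = n := by
  induction n with
  | zero => simp [vertexAt_zero]
  | succ n ih => rw [vertexAt_succ, childOf_sum, ih]

theorem vertexAt_congr {p q : ℕ → Bool} {n : ℕ} (h : ∀ i < n, p i = q i) :
    vertexAt p n = vertexAt q n := by
  induction n with
  | zero => simp [vertexAt_zero]
  | succ n ih =>
    rw [vertexAt_succ, vertexAt_succ, ih fun i hi => h i (by omega), h n (by omega)]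

theorem vertexAt_congr_of_tail {p q : ℕ → Bool} {m : ℕ} (hm : vertexAt p m = vertexAt q m)
    (h : ∀ i, m ≤ i → p i = q i) {n : ℕ} (hn : m ≤ n) : vertexAt p n = vertexAt q n := by
  induction n, hn using Nat.le_induction with
  | base => exact hm
  | succ n hn ih => rw [vertexAt_succ, vertexAt_succ, ih, h n hn]

theorem vertexAt_succ_snd (γ : ℕ → Bool) (n : ℕ) :
    (vertexAt γ (n + 1)).2 = (vertexAt γ n).2 + (γ n).toNat := by
  rw [vertexAt_succ]
  cases γ n <;> simp [childOf]

theorem isMinEdge_iff {ξ : ℕ × ℕ → Bool} {γ : ℕ → Bool} {i : ℕ} :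
    IsMinEdge ξ γ i ↔ (vertexAt γ (i + 1)).1 = 0 ∨ (vertexAt γ (i + 1)).2 = 0 ∨
      γ i = !ξ (vertexAt γ (i + 1)) := by
  rw [vertexAt_succ]; rfl

theorem isMaxEdge_iff {ξ : ℕ × ℕ → Bool} {γ : ℕ → Bool} {i : ℕ} :
    IsMaxEdge ξ γ i ↔ (vertexAt γ (i + 1)).1 = 0 ∨ (vertexAt γ (i + 1)).2 = 0 ∨
      γ i = ξ (vertexAt γ (i + 1)) := by
  rw [vertexAt_succ]; rfl

theorem isMinEdge_congr {ξ : ℕ × ℕ → Bool} {p q : ℕ → Bool} {i : ℕ}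
    (h : ∀ j ≤ i, p j = q j) : IsMinEdge ξ p i ↔ IsMinEdge ξ q i := by
  rw [isMinEdge_iff, isMinEdge_iff, vertexAt_congr fun j hj => h j (by omega), h i le_rfl]

/-- The reversed ordering. -/
def flipOrd (ξ : ℕ × ℕ → Bool) : ℕ × ℕ → Bool := fun v => !ξ v

theorem isMinEdge_flipOrd (ξ : ℕ × ℕ → Bool) : IsMinEdge (flipOrd ξ) = IsMaxEdge ξ := by
  funext γ i; rw [eq_iff_iff, isMinEdge_iff, isMaxEdge_iff]; simp [flipOrd]

theorem isMaxEdge_flipOrd (ξ : ℕ × ℕ → Bool) : IsMaxEdge (flipOrd ξ) = IsMinEdge ξ := by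
  funext γ i; rw [eq_iff_iff, isMinEdge_iff, isMaxEdge_iff]; simp [flipOrd]

theorem minPath_flipOrd (ξ : ℕ × ℕ → Bool) (v : ℕ × ℕ) : minPath (flipOrd ξ) v = maxPath ξ v := by
  induction v using maxPath.induct ξ with
  | case1 => simp [minPath, maxPath]
  | case2 => simp [minPath, maxPath, *]
  | case3 => simp [minPath, maxPath, *]
  | case4 x y h ih => simp_all [minPath, maxPath, flipOrd]
  | case5 x y h ih => simp_all [minPath, maxPath, flipOrd]

theorem adicT_flipOrd (ξ : ℕ × ℕ → Bool) : adicT (flipOrd ξ) = adicTInv ξ := by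
  funext γ
  classical
  by_cases h : ∃ i, ¬ IsMinEdge ξ γ i
  · have h' : ∃ i, ¬ IsMaxEdge (flipOrd ξ) γ i := by rwa [isMaxEdge_flipOrd]
    have hf : Nat.find h' = Nat.find h := Nat.find_congr' fun {n} => by rw [isMaxEdge_flipOrd]
    unfold adicT adicTInv
    rw [dif_pos h', dif_pos h]
    simp only [minPath_flipOrd, hf]
    funext n
    cases hv : ξ (vertexAt γ (Nat.find h + 1)) <;> simp [flipOrd, hv]
  · have h' : ¬ ∃ i, ¬ IsMaxEdge (flipOrd ξ) γ i := by rwa [isMaxEdge_flipOrd]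
    unfold adicT adicTInv
    rw [dif_neg h', dif_neg h]

theorem exists_minPath_eq_append (ξ : ℕ × ℕ → Bool) {v : ℕ × ℕ} (hv : v ≠ (0, 0)) :
    ∃ u m, minPath ξ v = minPath ξ u ++ [m] ∧ childOf u m = v ∧ MoveMin ξ u m := by
  match v with
  | (0, 0) => exact absurd rfl hv
  | (x + 1, 0) => exact ⟨(x, 0), false, by simp [minPath], by simp [childOf], by
      simp [MoveMin, childOf]⟩
  | (0, y + 1) => exact ⟨(0, y), true, by simp [minPath], by simp [childOf], by
      simp [MoveMin, childOf]⟩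
  | (x + 1, y + 1) =>
    cases h : ξ (x + 1, y + 1)
    · exact ⟨(x + 1, y), true, by simp [minPath, h], by simp [childOf], by
        simp [MoveMin, childOf, h]⟩
    · exact ⟨(x, y + 1), false, by simp [minPath, h], by simp [childOf], by
        simp [MoveMin, childOf, h]⟩

theorem minPath_spec (ξ : ℕ × ℕ → Bool) (N : ℕ) : ∀ v : ℕ × ℕ, v.1 + v.2 = N →
    (minPath ξ v).length = N ∧ ∀ δ : ℕ → Bool, (∀ i < N, δ i = (minPath ξ v).getD i false) →
      vertexAt δ N = v ∧ ∀ i < N, IsMinEdge ξ δ i := by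
  induction N with
  | zero =>
    rintro ⟨x, y⟩ h
    obtain ⟨rfl, rfl⟩ : x = 0 ∧ y = 0 := by simp at h; omega
    simp [minPath, vertexAt_zero]
  | succ N ih =>
    intro v hv
    obtain ⟨u, m, h1, h2, h3⟩ := exists_minPath_eq_append ξ (v := v) (by rintro rfl; simp at hv)
    have hu : u.1 + u.2 = N := by have := childOf_sum u m; rw [h2] at this; omega
    obtain ⟨hl, hs⟩ := ih u hu
    refine ⟨by simp [h1, hl], fun δ hδ => ?_⟩
    rw [h1] at hδ
    obtain ⟨hv1, hmin⟩ := hs δ fun i hi => by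
      rw [hδ i (by omega), List.getD_append _ _ _ _ (by omega)]
    have hN : δ N = m := by
      rw [hδ N (by omega), List.getD_append_right _ _ _ _ (by omega)]; simp [hl]
    refine ⟨by rw [vertexAt_succ, hv1, hN, h2], fun i hi => ?_⟩
    rcases Nat.lt_succ_iff_lt_or_eq.mp hi with hi | rfl
    · exact hmin i hi
    · rw [IsMinEdge, hv1, hN]; exact h3

/-- `q` is obtained from `p` by one adic step whose kink is at edge `m`, as far as the
edges from level `n` on are concerned. -/
structure IsAdicStep (ξ : ℕ × ℕ → Bool) (n : ℕ) (p q : ℕ → Bool) (m : ℕ) : Prop where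
  le : n ≤ m
  isMax : ∀ i, n ≤ i → i < m → IsMaxEdge ξ p i
  isMin : ∀ i, n ≤ i → i < m → IsMinEdge ξ q i
  not_isMax : ¬ IsMaxEdge ξ p m
  not_isMin : ¬ IsMinEdge ξ q m
  vertex : vertexAt p (m + 1) = vertexAt q (m + 1)
  tail : ∀ i, m < i → p i = q i

namespace IsAdicStep

variable {ξ : ℕ × ℕ → Bool} {n m : ℕ} {p q : ℕ → Bool}

theorem symm (h : IsAdicStep ξ n p q m) : IsAdicStep (flipOrd ξ) n q p m where
  le := h.le
  isMax i h1 h2 := by rw [isMaxEdge_flipOrd]; exact h.isMin i h1 h2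
  isMin i h1 h2 := by rw [isMinEdge_flipOrd]; exact h.isMax i h1 h2
  not_isMax := by rw [isMaxEdge_flipOrd]; exact h.not_isMin
  not_isMin := by rw [isMinEdge_flipOrd]; exact h.not_isMax
  vertex := h.vertex.symm
  tail i hi := (h.tail i hi).symm

theorem vertex_of_lt (h : IsAdicStep ξ n p q m) {i : ℕ} (hi : m < i) :
    vertexAt p i = vertexAt q i :=
  vertexAt_congr_of_tail h.vertex h.tail hi

end IsAdicStep

theorem isAdicStep_adicT {ξ : ℕ × ℕ → Bool} {γ : ℕ → Bool} (hγ : γ ∉ XMax ξ) :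
    ∃ m, IsAdicStep ξ 0 γ (adicT ξ γ) m := by
  classical
  have h : ∃ i, ¬ IsMaxEdge ξ γ i := by simpa [XMax] using hγ
  have hm := Nat.find_spec h
  have hlt : ∀ i < Nat.find h, IsMaxEdge ξ γ i := fun i hi => not_not.mp (Nat.find_min h hi)
  unfold adicT
  rw [dif_pos h]
  generalize Nat.find h = m at hm hlt
  refine ⟨m, ?_⟩
  have hsum := vertexAt_sum γ (m + 1)
  have hm' := hm
  rw [isMaxEdge_iff] at hm'
  push Not at hm'
  dsimp only
  generalize hv : vertexAt γ (m + 1) = v at hm' hsum ⊢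
  generalize hs : (if ξ v = true then (v.1, v.2 - 1) else (v.1 - 1, v.2) : ℕ × ℕ) = src
  obtain ⟨x, y⟩ := v
  simp only at hm' hsum hs
  have hsrc : src.1 + src.2 = m ∧ childOf src (ξ (x, y)) = (x, y) := by
    subst hs
    cases ξ (x, y) <;> simp [childOf] <;> omega
  set q : ℕ → Bool := fun n => if n < m then (minPath ξ src).getD n false
    else if n = m then ξ (x, y) else γ n with hq
  obtain ⟨hv1, hmin⟩ := (minPath_spec ξ m src hsrc.1).2 q fun i hi => by simp [hq, hi]
  have hqm : q m = ξ (x, y) := by simp [hq]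
  have hv2 : vertexAt q (m + 1) = (x, y) := by rw [vertexAt_succ, hv1, hqm, hsrc.2]
  refine ⟨Nat.zero_le _, fun i _ => hlt i, fun i _ => hmin i, hm, ?_, by rw [hv, hv2], ?_⟩
  · rw [isMinEdge_iff, hv2, hqm]
    simp [hm'.1, hm'.2.1]
  · intro i hi
    simp [hq, show ¬ i < m by omega, show i ≠ m by omega]

theorem isAdicStep_adicTInv {ξ : ℕ × ℕ → Bool} {γ : ℕ → Bool} (hγ : γ ∉ XMin ξ) :
    ∃ m, IsAdicStep ξ 0 (adicTInv ξ γ) γ m := by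
  have h : γ ∉ XMax (flipOrd ξ) := by simpa [XMax, XMin, isMaxEdge_flipOrd] using hγ
  obtain ⟨m, hm⟩ := isAdicStep_adicT h
  refine ⟨m, ?_⟩
  have := hm.symm
  rwa [adicT_flipOrd, show flipOrd (flipOrd ξ) = ξ by funext v; simp [flipOrd]] at this

theorem XPrime_of_tail {ξ : ℕ × ℕ → Bool} {p q : ℕ → Bool} {m : ℕ}
    (h : ∀ i, m < i → p i = q i) (hp : p ∉ XPrime ξ) : q ∉ XPrime ξ := by
  rintro ⟨δ, hδ, N, hN⟩
  exact hp ⟨δ, hδ, max N (m + 1), fun n hn => by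
    rw [h n (by omega), hN n (by omega)]⟩

theorem not_mem_XMax {ξ : ℕ × ℕ → Bool} {p : ℕ → Bool} (hp : p ∉ XPrime ξ) : p ∉ XMax ξ :=
  fun h => hp ⟨p, Or.inr h, 0, fun _ _ => rfl⟩

theorem not_mem_XMin {ξ : ℕ × ℕ → Bool} {p : ℕ → Bool} (hp : p ∉ XPrime ξ) : p ∉ XMin ξ :=
  fun h => hp ⟨p, Or.inl h, 0, fun _ _ => rfl⟩

theorem iterate_adicT_not_mem {ξ : ℕ × ℕ → Bool} {γ : ℕ → Bool} (hγ : γ ∉ XPrime ξ) (n : ℕ) :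
    (adicT ξ)^[n] γ ∉ XPrime ξ := by
  induction n with
  | zero => exact hγ
  | succ n ih =>
    rw [Function.iterate_succ_apply']
    obtain ⟨m, hm⟩ := isAdicStep_adicT (not_mem_XMax ih)
    exact XPrime_of_tail hm.tail ih

theorem iterate_adicTInv_not_mem {ξ : ℕ × ℕ → Bool} {γ : ℕ → Bool} (hγ : γ ∉ XPrime ξ) (n : ℕ) :
    (adicTInv ξ)^[n] γ ∉ XPrime ξ := by
  induction n with
  | zero => exact hγ
  | succ n ih =>
    rw [Function.iterate_succ_apply']
    obtain ⟨m, hm⟩ := isAdicStep_adicTInv (not_mem_XMin ih)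
    exact XPrime_of_tail (fun i hi => (hm.tail i hi).symm) ih

theorem isAdicStep_adicIter {ξ : ℕ × ℕ → Bool} {γ : ℕ → Bool} (hγ : γ ∉ XPrime ξ) (t : ℤ) :
    ∃ m, IsAdicStep ξ 0 (adicIter ξ t γ) (adicIter ξ (t + 1) γ) m := by
  match t with
  | Int.ofNat n =>
    have := isAdicStep_adicT (not_mem_XMax (iterate_adicT_not_mem hγ n))
    rwa [← Function.iterate_succ_apply' (adicT ξ)] at this
  | Int.negSucc 0 => exact isAdicStep_adicTInv (not_mem_XMin hγ)
  | Int.negSucc (n + 1) =>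
    have := isAdicStep_adicTInv (not_mem_XMin (iterate_adicTInv_not_mem hγ (n + 1)))
    rwa [← Function.iterate_succ_apply' (adicTInv ξ)] at this

/-- A bi-infinite adic orbit seen from level `n` on, with kinks `M`. -/
def IsAdicOrbit (ξ : ℕ × ℕ → Bool) (n : ℕ) (p : ℤ → ℕ → Bool) (M : ℤ → ℕ) : Prop :=
  ∀ k, IsAdicStep ξ n (p k) (p (k + 1)) (M k)

namespace IsAdicOrbit

variable {ξ : ℕ × ℕ → Bool} {n : ℕ} {p : ℤ → ℕ → Bool} {M : ℤ → ℕ}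

theorem reverse (h : IsAdicOrbit ξ n p M) :
    IsAdicOrbit (flipOrd ξ) n (fun k => p (-k)) (fun k => M (-k - 1)) := by
  intro k
  have := (h (-k - 1)).symm
  simpa [show -(k + 1) = -k - 1 by ring] using this

theorem edges_eq_of_lt (h : IsAdicOrbit ξ 0 p M) {s t : ℤ} (hst : s ≤ t)
    (hM : ∀ u, s ≤ u → u < t → M u < n) :
    (∀ i, n ≤ i → p s i = p t i) ∧ vertexAt (p s) n = vertexAt (p t) n := by
  induction t, hst using Int.leInduction with
  | base => simp
  | succ t hst ih =>
    obtain ⟨h1, h2⟩ := ih fun u hu hut => hM u hu (by omega)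
    have hlt := hM t hst (by omega)
    exact ⟨fun i hi => (h1 i hi).trans ((h t).tail i (by omega)),
      h2.trans ((h t).vertex_of_lt hlt)⟩

theorem isMax_of_eq (h : IsAdicOrbit ξ n p M) (k : ℤ) : IsMaxEdge ξ (p (k + 1)) (M k) := by
  have := (h k).not_isMin
  rw [isMinEdge_iff] at this
  rw [isMaxEdge_iff]
  push Not at this
  exact Or.inr (Or.inr (Bool.not_eq_not.mp this.2.2))

theorem exists_kink_ge (h : IsAdicOrbit ξ 0 p M) (n : ℕ) (t : ℤ) : ∃ u, t ≤ u ∧ n ≤ M u := by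
  induction n generalizing t with
  | zero => exact ⟨t, le_rfl, Nat.zero_le _⟩
  | succ n ih =>
    obtain ⟨u, hu, hMu⟩ := ih t
    by_cases hlt : n + 1 ≤ M u
    · exact ⟨u, hu, hlt⟩
    have hMn : M u = n := by omega
    obtain ⟨w, ⟨hw1, hw2⟩, hw3⟩ := Int.exists_least_of_bdd (P := fun w => u + 1 ≤ w ∧ n ≤ M w)
      ⟨u + 1, fun z hz => hz.1⟩ (ih (u + 1))
    refine ⟨w, by omega, ?_⟩
    obtain ⟨he, hv⟩ := h.edges_eq_of_lt (n := n) hw1 fun z hz1 hz2 => by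
      by_contra hcon
      have := hw3 z ⟨hz1, by omega⟩
      omega
    by_contra hcon
    have hw : M w = n := by omega
    have h1 := h.isMax_of_eq u
    have h2 := (h w).not_isMax
    rw [hMn, IsMaxEdge, hv, he n le_rfl] at h1
    rw [hw] at h2
    exact h2 h1

theorem cut_iff (h : IsAdicOrbit ξ 0 p M) (n : ℕ) (t : ℤ) :
    (∀ i < n, IsMinEdge ξ (p (t + 1)) i) ↔ n ≤ M t := by
  constructor
  · intro hc
    by_contra hlt
    exact (h t).not_isMin (hc _ (by omega))
  · exact fun hle i hi => (h t).isMin i (Nat.zero_le _) (by omega)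

theorem exists_cut_gt (h : IsAdicOrbit ξ 0 p M) (n : ℕ) (t : ℤ) :
    ∃ u, t < u ∧ n ≤ M (u - 1) := by
  obtain ⟨u, hu, hM⟩ := h.exists_kink_ge n t
  exact ⟨u + 1, by omega, by simpa using hM⟩

theorem exists_cut_lt (h : IsAdicOrbit ξ 0 p M) (n : ℕ) (t : ℤ) :
    ∃ u, u < t ∧ n ≤ M (u - 1) := by
  obtain ⟨u, hu, hM⟩ := h.reverse.exists_kink_ge n (1 - t)
  exact ⟨-u, by omega, hM⟩

end IsAdicOrbit

/-- A subset of `ℤ` unbounded in both directions is enumerated by `ℤ` in increasing order. -/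
theorem exists_int_enumeration (S : ℤ → Prop) (hgt : ∀ t, ∃ u, t < u ∧ S u)
    (hlt : ∀ t, ∃ u, u < t ∧ S u) :
    ∃ c : ℤ → ℤ, (∀ k, S (c k)) ∧ (∀ k, c k < c (k + 1)) ∧
      (∀ k u, c k < u → u < c (k + 1) → ¬ S u) ∧ ∀ t, ∃ k, c k ≤ t ∧ t < c (k + 1) := by
  classical
  have : Nonempty {t // S t} := let ⟨u, _, hu⟩ := hgt 0; ⟨⟨u, hu⟩⟩
  have : NoMaxOrder {t // S t} := ⟨fun t => let ⟨u, h, hu⟩ := hgt t; ⟨⟨u, hu⟩, h⟩⟩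
  have : NoMinOrder {t // S t} := ⟨fun t => let ⟨u, h, hu⟩ := hlt t; ⟨⟨u, hu⟩, h⟩⟩
  let : SuccOrder {t // S t} := LinearLocallyFiniteOrder.succOrder _
  let : PredOrder {t // S t} := LinearLocallyFiniteOrder.predOrder _
  let e : {t // S t} ≃o ℤ := orderIsoIntOfLinearSuccPredArch
  have hbetween : ∀ k u, (e.symm k : ℤ) < u → u < e.symm (k + 1) → ¬ S u := by
    intro k u h1 h2 hu
    have h1' : e.symm k < ⟨u, hu⟩ := h1
    have h2' : (⟨u, hu⟩ : {t // S t}) < e.symm (k + 1) := h2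
    rw [e.symm_apply_lt] at h1'
    rw [e.lt_symm_apply] at h2'
    omega
  refine ⟨fun k => e.symm k, fun k => (e.symm k).2, fun k => ?_, hbetween, fun t => ?_⟩
  · exact e.symm.strictMono (lt_add_one k)
  · obtain ⟨u, hu, hSu⟩ := hlt t
    obtain ⟨w, ⟨hw1, hw2⟩, hw3⟩ := Int.exists_greatest_of_bdd (P := fun w => w ≤ t ∧ S w)
      ⟨t, fun z hz => hz.1⟩ ⟨u, hu.le, hSu⟩
    refine ⟨e ⟨w, hw2⟩, by simpa using hw1, ?_⟩
    by_contra hcon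
    have h1 := hw3 _ ⟨not_lt.mp hcon, (e.symm (e ⟨w, hw2⟩ + 1)).2⟩
    have h2 := e.symm.strictMono (lt_add_one (e ⟨w, hw2⟩))
    rw [e.symm_apply_apply] at h2
    exact absurd h1 (not_le.mpr h2)

/-- A factorization of a sequence `a` over `{0, …, n}` into the letters `b` of the next level:
`J k` says that positions `k` and `k + 1` lie in the same factor, and `o c` that the factor of
the letter `c` is `(c - 1) c` rather than `c (c - 1)`. -/
structure IsFactoring (n : ℤ) (o : ℤ → Prop) (a b : ℤ → ℤ) (J : ℤ → Prop) : Prop where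
  range : ∀ k, 0 ≤ a k ∧ a k ≤ n
  letter : ∀ k, b k = a k ∨ b k = a k + 1
  disjoint : ∀ k, J k → ¬ J (k + 1)
  pair : ∀ k, J k → (o (b k) ∧ a k = b k - 1 ∧ a (k + 1) = b k ∧ b (k + 1) = b k) ∨
    (¬ o (b k) ∧ a k = b k ∧ a (k + 1) = b k - 1 ∧ b (k + 1) = b k)
  single : ∀ k, ¬ J k → ¬ J (k + 1) → b (k + 1) = 0 ∨ b (k + 1) = n + 1
  neighbour : ∀ k, J k → |b (k - 1) - b k| ≤ 1 ∨ |b (k + 2) - b k| ≤ 1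

namespace IsFactoring

variable {n : ℤ} {o : ℤ → Prop} {a b b' : ℤ → ℤ} {J J' : ℤ → Prop}

theorem compl (h : IsFactoring n o a b J) :
    IsFactoring n (fun c => ¬ o (n + 1 - c)) (fun k => n - a k) (fun k => n + 1 - b k) J where
  range k := by have := h.range k; omega
  letter k := by have := h.letter k; omega
  disjoint := h.disjoint
  pair k hk := by
    have := h.pair k hk
    simp only [sub_sub_cancel, not_not]
    rcases this with ⟨h1, h2, h3, h4⟩ | ⟨h1, h2, h3, h4⟩
    · exact Or.inr ⟨h1, by omega, by omega, by omega⟩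
    · exact Or.inl ⟨h1, by omega, by omega, by omega⟩
  single k h1 h2 := by have := h.single k h1 h2; omega
  neighbour k hk := by
    have := h.neighbour k hk
    simp only [abs_le] at this ⊢
    omega

theorem reverse (h : IsFactoring n o a b J) :
    IsFactoring n (fun c => ¬ o c) (fun k => a (-k)) (fun k => b (-k)) (fun k => J (-k - 1)) where
  range k := h.range _
  letter k := h.letter _
  disjoint k h1 h2 := h.disjoint _ h2 (by convert h1 using 1; ring)
  pair k hk := by
    have := h.pair _ hk
    rw [show -k - 1 + 1 = -k by ring] at this
    rw [show -(k + 1) = -k - 1 by ring]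
    rcases this with ⟨h1, h2, h3, h4⟩ | ⟨h1, h2, h3, h4⟩ <;> rw [← h4] at h1
    · exact Or.inr ⟨not_not.mpr h1, by omega, by omega, by omega⟩
    · exact Or.inl ⟨h1, by omega, by omega, by omega⟩
  single k h1 h2 := by
    have := h.single (-(k + 1) - 1) h2 (by convert h1 using 2; ring)
    rwa [show -(k + 1) - 1 + 1 = -(k + 1) by ring] at this
  neighbour k hk := by
    have h1 := h.neighbour _ hk
    have h2 := h.pair _ hk
    rw [show -k - 1 + 1 = -k by ring] at h2
    rw [show -k - 1 - 1 = -(k + 2) by ring, show -k - 1 + 2 = -(k - 1) by ring] at h1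
    have h3 : b (-k) = b (-k - 1) := by rcases h2 with h | h <;> exact h.2.2.2
    rw [h3]
    exact h1.symm

theorem step_of_joined (h : IsFactoring n o a b J) {k : ℤ} (hk : J k) :
    (o (a k + 1) ∧ b k = a k + 1 ∧ b (k + 1) = a k + 1 ∧ a (k + 1) = a k + 1) ∨
    (¬ o (a k) ∧ b k = a k ∧ b (k + 1) = a k ∧ a (k + 1) = a k - 1) := by
  rcases h.pair k hk with ⟨h1, h2, h3, h4⟩ | ⟨h1, h2, h3, h4⟩
  · exact Or.inl ⟨by rwa [h2, sub_add_cancel], by omega, by omega, by omega⟩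
  · exact Or.inr ⟨by rwa [h2], by omega, by omega, by omega⟩

/-- Two overlapping factors of different factorizations are traversed in the same direction. -/
theorem ascend (h : IsFactoring n o a b J) (h' : IsFactoring n o a b' J') {k : ℤ} (hk : J k)
    (hk' : J' (k + 1)) (ha : a (k + 1) = a k + 1) :
    b' (k + 1) = a k + 2 ∧ b' (k + 2) = a k + 2 ∧ a (k + 2) = a k + 2 := by
  have h1 := h.step_of_joined hk
  have h2 := h'.step_of_joined hk'
  rw [show k + 1 + 1 = k + 2 by ring] at h2
  rcases h1 with ⟨h1, -⟩ | h1
  · rcases h2 with h2 | ⟨h2, -⟩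
    · omega
    · rw [ha] at h2; exact absurd h1 h2
  · omega

theorem joined_of_interior (h : IsFactoring n o a b J) {k : ℤ} (hk : ¬ J k)
    (h0 : 0 < a (k + 1)) (hn : a (k + 1) < n) : J (k + 1) := by
  by_contra hcon
  have := h.single k hk hcon
  have := h.letter (k + 1)
  omega

theorem joined_of_joined_zero (hn : 3 ≤ n) (h : IsFactoring n o a b J)
    (h' : IsFactoring n o a b' J') {k : ℤ} (hk' : ¬ J' k) (hJ : J (k + 1))
    (ha : a (k + 1) = 0) : J' (k + 1) := by
  by_contra hJ'
  have r := h.range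
  have hb1 := h'.single k hk' hJ'
  have hl1 := h'.letter (k + 1)
  have h2 : a (k + 1 + 1) = a (k + 1) + 1 := by
    rcases h.step_of_joined hJ with h | h
    · exact h.2.2.2
    · have := r (k + 1 + 1); omega
  have hJ'2 : J' (k + 1 + 1) := h'.joined_of_interior hJ' (by omega) (by omega)
  obtain ⟨e1, e2, e3⟩ := h.ascend h' hJ hJ'2 h2
  have hJ2 := h.disjoint _ hJ
  have hJ3 : J (k + 1 + 1 + 1) := h.joined_of_interior hJ2
    (by rw [show k + 1 + 1 + 1 = k + 1 + 2 by ring]; omega)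
    (by rw [show k + 1 + 1 + 1 = k + 1 + 2 by ring]; omega)
  obtain ⟨f1, f2, f3⟩ := h'.ascend h hJ'2 hJ3
    (by rw [show k + 1 + 1 + 1 = k + 1 + 2 by ring]; omega)
  have hJ'3 := h'.disjoint _ hJ'2
  have hb4 : b' (k + 1 + 1 + 2) = 4 := by
    by_cases hJ'4 : J' (k + 1 + 1 + 1 + 1)
    · have := h.ascend h' hJ3 hJ'4 (by
        rw [show k + 1 + 1 + 1 + 1 = k + 1 + 1 + 2 by ring, show k + 1 + 1 + 1 = k + 1 + 2 by ring]
        omega)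
      rw [show k + 1 + 1 + 1 + 1 = k + 1 + 1 + 2 by ring,
        show k + 1 + 1 + 1 = k + 1 + 2 by ring] at this
      omega
    · have s1 := h'.single _ hJ'3 hJ'4
      have s2 := h'.letter (k + 1 + 1 + 1 + 1)
      rw [show k + 1 + 1 + 1 + 1 = k + 1 + 1 + 2 by ring] at s1 s2
      have := r (k + 1 + 1 + 2)
      omega
  have := h'.neighbour _ hJ'2
  rw [show k + 1 + 1 - 1 = k + 1 by ring] at this
  simp only [abs_le] at this
  omega

theorem joined_of_joined (hn : 3 ≤ n) (h : IsFactoring n o a b J)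
    (h' : IsFactoring n o a b' J') {k : ℤ} (hk' : ¬ J' k) (hJ : J (k + 1)) : J' (k + 1) := by
  by_contra hJ'
  have hb1 := h'.single k hk' hJ'
  have hl1 := h'.letter (k + 1)
  have hr := h.range (k + 1)
  rcases hb1 with hb | hb
  · exact hJ' (joined_of_joined_zero hn h h' hk' hJ (by omega))
  · exact hJ' (joined_of_joined_zero hn h.compl h'.compl hk' hJ (by omega))

theorem joined_iff_of_ge (hn : 3 ≤ n) (h : IsFactoring n o a b J)
    (h' : IsFactoring n o a b' J') {k : ℤ} (hk : ¬ J k) (hk' : ¬ J' k) {l : ℤ} (hl : k ≤ l) :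
    J l ↔ J' l := by
  suffices H : (J l ↔ J' l) ∧ (J (l + 1) ↔ J' (l + 1)) from H.1
  have key : ∀ l, ¬ J l → ¬ J' l → (J (l + 1) ↔ J' (l + 1)) := fun l h1 h2 =>
    ⟨joined_of_joined hn h h' h2, joined_of_joined hn h' h h1⟩
  induction l, hl using Int.leInduction with
  | base => exact ⟨by simp [hk, hk'], key k hk hk'⟩
  | succ l hl ih =>
    refine ⟨ih.2, ?_⟩
    by_cases hJ : J (l + 1)
    · have h1 := h.disjoint _ hJ
      have h2 := h'.disjoint _ (ih.2.mp hJ)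
      simp [h1, h2]
    · exact key _ hJ (fun hc => hJ (ih.2.mpr hc))

theorem exists_common_cut_of_ascend (h : IsFactoring n o a b J) (h' : IsFactoring n o a b' J')
    (ha : a 1 = a 0 + 1) : ∃ k, ¬ J k ∧ ¬ J' k := by
  by_contra! hcon
  have hcon' : ∀ k, ¬ J' k → J k := fun k hk => by by_contra hJ; exact hk (hcon k hJ)
  have key : ∀ m : ℕ, a (m + 1) = a m + 1 ∧ a m = a 0 + m := by
    intro m
    induction m with
    | zero => simpa using ha
    | succ m ih =>
      have : a ((m : ℤ) + 2) = a m + 2 := by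
        by_cases hJ : J m
        · exact (h.ascend h' hJ (hcon _ (h.disjoint _ hJ)) ih.1).2.2
        · have hJ' := hcon _ hJ
          exact (h'.ascend h hJ' (hcon' _ (h'.disjoint _ hJ')) ih.1).2.2
      push_cast
      rw [show (m : ℤ) + 1 + 1 = m + 2 by ring]
      omega
  have h1 := (key (n + 1).toNat).2
  have h2 := h.range 0
  have h3 := h.range ((n + 1).toNat : ℤ)
  omega

theorem exists_common_cut (h : IsFactoring n o a b J) (h' : IsFactoring n o a b' J') :
    ∃ k, ¬ J k ∧ ¬ J' k := by
  by_cases hJ : J 0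
  · rcases h.step_of_joined hJ with h1 | h1
    · exact exists_common_cut_of_ascend h h' h1.2.2.2
    · exact exists_common_cut_of_ascend h.compl h'.compl (by
        have := h1.2.2.2
        rw [zero_add] at this
        omega)
  · by_cases hJ' : J' 0
    · rcases h'.step_of_joined hJ' with h1 | h1
      · exact exists_common_cut_of_ascend h h' h1.2.2.2
      · exact exists_common_cut_of_ascend h.compl h'.compl (by
          have := h1.2.2.2
          rw [zero_add] at this
          omega)
    · exact ⟨0, hJ, hJ'⟩

theorem joined_iff (hn : 3 ≤ n) (h : IsFactoring n o a b J) (h' : IsFactoring n o a b' J')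
    (l : ℤ) : J l ↔ J' l := by
  obtain ⟨k, hk, hk'⟩ := exists_common_cut h h'
  rcases le_total k l with hl | hl
  · exact joined_iff_of_ge hn h h' hk hk' hl
  · have := joined_iff_of_ge hn h.reverse h'.reverse (k := -k - 1) (l := -l - 1)
      (by simpa using hk) (by simpa using hk') (by omega)
    simpa using this

theorem letter_unique (hn : 3 ≤ n) (h : IsFactoring n o a b J) (h' : IsFactoring n o a b' J')
    (k : ℤ) : b k = b' k := by
  have hiff := joined_iff hn h h'
  obtain ⟨l, rfl⟩ : ∃ l, k = l + 1 := ⟨k - 1, by ring⟩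
  by_cases hJ : J l
  · have h1 := h.step_of_joined hJ
    have h2 := h'.step_of_joined ((hiff _).mp hJ)
    omega
  by_cases hJ1 : J (l + 1)
  · have h1 := h.step_of_joined hJ1
    have h2 := h'.step_of_joined ((hiff _).mp hJ1)
    omega
  have h1 := h.single l hJ hJ1
  have h2 := h'.single l (mt (hiff _).mpr hJ) (mt (hiff _).mpr hJ1)
  have h3 := h.letter (l + 1)
  have h4 := h'.letter (l + 1)
  omega

end IsFactoring

namespace IsAdicOrbit

variable {ξ : ℕ × ℕ → Bool} {n : ℕ} {p : ℤ → ℕ → Bool} {M : ℤ → ℕ}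

theorem vertexAt_eq (γ : ℕ → Bool) (n : ℕ) :
    vertexAt γ n = (n - (vertexAt γ n).2, (vertexAt γ n).2) := by
  have := vertexAt_sum γ n
  ext
  · omega
  · rfl

theorem kink_spec (h : IsAdicOrbit ξ n p M) (k : ℤ) {m : ℕ} (hm : M k = m) :
    vertexAt (p (k + 1)) (m + 1) = vertexAt (p k) (m + 1) ∧
    0 < (vertexAt (p k) (m + 1)).2 ∧ (vertexAt (p k) (m + 1)).2 < m + 1 ∧
    p k m = (!ξ (vertexAt (p k) (m + 1))) ∧ p (k + 1) m = ξ (vertexAt (p k) (m + 1)) := by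
  subst hm
  have h1 := (h k).not_isMax
  have h2 := (h k).not_isMin
  rw [isMaxEdge_iff] at h1
  rw [isMinEdge_iff] at h2
  push Not at h1 h2
  have hs := vertexAt_sum (p k) (M k + 1)
  have hv := (h k).vertex
  refine ⟨hv.symm, by omega, by omega, Bool.eq_not_iff.mpr h1.2.2, ?_⟩
  rw [hv]
  exact Bool.not_eq_not.mp h2.2.2

theorem extreme_of_isMin_isMax {γ : ℕ → Bool} {i : ℕ} (h1 : IsMinEdge ξ γ i)
    (h2 : IsMaxEdge ξ γ i) : (vertexAt γ (i + 1)).2 = 0 ∨ (vertexAt γ (i + 1)).2 = i + 1 := by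
  rw [isMaxEdge_iff] at h2
  rw [isMinEdge_iff] at h1
  have hs := vertexAt_sum γ (i + 1)
  by_contra hcon
  have e1 : γ i = !ξ (vertexAt γ (i + 1)) := by
    rcases h1 with h | h | h
    · omega
    · omega
    · exact h
  have e2 : γ i = ξ (vertexAt γ (i + 1)) := by
    rcases h2 with h | h | h
    · omega
    · omega
    · exact h
  rw [e2] at e1
  simp at e1

theorem isFactoring (h : IsAdicOrbit ξ n p M) :
    IsFactoring n (fun c => ξ (n + 1 - c.toNat, c.toNat) = false)
      (fun k => (vertexAt (p k) n).2) (fun k => (vertexAt (p k) (n + 1)).2)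
      (fun k => M k = n) where
  range k := by have := vertexAt_sum (p k) n; omega
  letter k := by
    rw [vertexAt_succ_snd]
    cases p k n <;> simp
  disjoint k h1 h2 := by
    have e1 := h.kink_spec k h1
    have e2 := h.kink_spec (k + 1) h2
    have := e2.2.2.2.1
    rw [e1.1, e1.2.2.2.2] at this
    simp at this
  pair k hk := by
    obtain ⟨h1, h2, h3, h4, h5⟩ := h.kink_spec k hk
    have e1 := vertexAt_succ_snd (p k) n
    have e2 := vertexAt_succ_snd (p (k + 1)) n
    have hv := vertexAt_eq (p k) (n + 1)
    rw [Int.toNat_natCast, ← hv]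
    rw [h1] at e2 ⊢
    rw [h4] at e1
    rw [h5] at e2
    cases hx : ξ (vertexAt (p k) (n + 1)) <;> simp [hx] at e1 e2 ⊢ <;> omega
  single k h1 h2 := by
    have l1 := (h k).le
    have l2 := (h (k + 1)).le
    have := extreme_of_isMin_isMax ((h k).isMin n le_rfl (by omega))
      ((h (k + 1)).isMax n le_rfl (by omega))
    omega
  neighbour k hk := by
    obtain ⟨h1, h2, h3, h4, h5⟩ := h.kink_spec k hk
    have hnext : M (k + 1) ≠ n := fun hc => by
      have := (h.kink_spec (k + 1) hc).2.2.2.1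
      rw [h1, h5] at this
      simp at this
    have hprev : M (k - 1) ≠ n := fun hc => by
      have e := h.kink_spec (k - 1) hc
      rw [sub_add_cancel] at e
      have := e.2.2.2.2
      rw [← e.1, h4] at this
      simp at this
    have l1 := (h (k + 1)).le
    have l2 := (h (k - 1)).le
    have c0 := vertexAt_succ_snd (p k) (n + 1)
    have bt : ∀ x : Bool, x.toNat ≤ 1 := Bool.toNat_le
    simp only [abs_le]
    by_cases hn2 : M (k + 1) = n + 1
    · have e := h.kink_spec _ hn2
      right
      have c1 := vertexAt_succ_snd (p (k + 1)) (n + 1)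
      have c2 := vertexAt_succ_snd (p (k + 1 + 1)) (n + 1)
      rw [e.1] at c2
      rw [h1] at c1
      rw [show k + 1 + 1 = k + 2 by ring] at c2
      have b1 := bt (p (k + 1) (n + 1))
      have b2 := bt (p (k + 2) (n + 1))
      omega
    by_cases hn1 : M (k - 1) = n + 1
    · have e := h.kink_spec _ hn1
      left
      rw [sub_add_cancel] at e
      have c2 := vertexAt_succ_snd (p (k - 1)) (n + 1)
      rw [e.1] at c0
      have b1 := bt (p k (n + 1))
      have b2 := bt (p (k - 1) (n + 1))
      omega
    have m1 := (h (k + 1)).isMax (n + 1) (by omega) (by omega)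
    have m2 := (h (k - 1)).isMin (n + 1) (by omega) (by omega)
    rw [sub_add_cancel] at m2
    rw [IsMaxEdge, h1, ← (h k).tail (n + 1) (by omega)] at m1
    have := extreme_of_isMin_isMax m2 m1
    have := bt (p k (n + 1))
    omega

/-- The orbit induced on the starting times of the level-`n` blocks. -/
theorem induced (h : IsAdicOrbit ξ 0 p M) {c : ℤ → ℤ} (hc : ∀ k, n ≤ M (c k - 1))
    (hlt : ∀ k, c k < c (k + 1))
    (hgap : ∀ k u, c k < u → u < c (k + 1) → ¬ n ≤ M (u - 1)) :
    IsAdicOrbit ξ n (fun k => p (c k)) (fun k => M (c (k + 1) - 1)) := by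
  intro k
  have hst : c k ≤ c (k + 1) - 1 := by have := hlt k; omega
  obtain ⟨he, hv⟩ := h.edges_eq_of_lt (n := n) hst fun u h1 h2 => by
    have := hgap k (u + 1) (by omega) (by omega)
    rw [add_sub_cancel_right] at this
    omega
  have hV : ∀ i, n ≤ i → vertexAt (p (c k)) i = vertexAt (p (c (k + 1) - 1)) i :=
    fun i hi => vertexAt_congr_of_tail hv he hi
  have hmax : ∀ i, n ≤ i →
      (IsMaxEdge ξ (p (c k)) i ↔ IsMaxEdge ξ (p (c (k + 1) - 1)) i) := fun i hi => by
    rw [IsMaxEdge, IsMaxEdge, hV i hi, he i hi]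
  have hs := h (c (k + 1) - 1)
  rw [sub_add_cancel] at hs
  have hle := hc (k + 1)
  exact
    { le := hle
      isMax := fun i h1 h2 => (hmax i h1).mpr (hs.isMax i (Nat.zero_le _) h2)
      isMin := fun i _ h2 => hs.isMin i (Nat.zero_le _) h2
      not_isMax := mt (hmax _ hle).mp hs.not_isMax
      not_isMin := hs.not_isMin
      vertex := (hV _ (Nat.le_succ_of_le hle)).trans hs.vertex
      tail := fun i hi => (he i (hle.trans (le_of_lt hi))).trans (hs.tail i hi) }

/-- From level three on, the coding at one level determines the coding at the next. -/
theorem edge_eq_of_lt_eq {p' : ℤ → ℕ → Bool} {M' : ℤ → ℕ} (hn : 3 ≤ n)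
    (h : IsAdicOrbit ξ 0 p M) (h' : IsAdicOrbit ξ 0 p' M')
    (heq : ∀ t, ∀ i < n, p t i = p' t i) (t : ℤ) : p t n = p' t n := by
  have hcut : ∀ t, n ≤ M (t - 1) ↔ n ≤ M' (t - 1) := fun t => by
    rw [← h.cut_iff, ← h'.cut_iff]
    exact forall₂_congr fun i hi => isMinEdge_congr fun j hj => heq _ j (by omega)
  obtain ⟨c, hc, hlt, hgap, hcov⟩ := exists_int_enumeration (fun t => n ≤ M (t - 1))
    (h.exists_cut_gt n) (h.exists_cut_lt n)
  have F := (h.induced hc hlt hgap).isFactoring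
  have F' := (h'.induced (fun k => (hcut _).mp (hc k)) hlt
    fun k u h1 h2 => mt (hcut _).mpr (hgap k u h1 h2)).isFactoring
  have ha : ∀ t, vertexAt (p t) n = vertexAt (p' t) n := fun t => vertexAt_congr (heq t)
  simp only [← ha] at F'
  obtain ⟨k, hk1, hk2⟩ := hcov t
  have hb := IsFactoring.letter_unique (by exact_mod_cast hn) F F' k
  have hbe : p (c k) n = p' (c k) n := by
    simp only [vertexAt_succ_snd, ← ha] at hb
    cases h1 : p (c k) n <;> cases h2 : p' (c k) n <;> simp [h1, h2] at hb ⊢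
  have hsmall : ∀ u, c k ≤ u → u < t → ¬ n ≤ M u := fun u h1 h2 => by
    simpa using hgap k (u + 1) (by omega) (by omega)
  have e1 := (h.edges_eq_of_lt (n := n) hk1 fun u h1 h2 => by
    have := hsmall u h1 h2; omega).1 n le_rfl
  have e2 := (h'.edges_eq_of_lt (n := n) hk1 fun u h1 h2 => by
    have h3 := hsmall u h1 h2
    have h4 := hcut (u + 1)
    rw [add_sub_cancel_right] at h4
    omega).1 n le_rfl
  rw [← e1, ← e2, hbe]

end IsAdicOrbit

theorem exists_isAdicOrbit {ξ : ℕ × ℕ → Bool} {γ : ℕ → Bool} (hγ : γ ∉ XPrime ξ) :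
    ∃ M, IsAdicOrbit ξ 0 (fun t => adicIter ξ t γ) M := by
  choose M hM using isAdicStep_adicIter hγ
  exact ⟨M, hM⟩

theorem stmt5 (ξ : ℕ × ℕ → Bool) (γ γ' : ℕ → Bool)
    (hγ : γ ∉ XPrime ξ) (hγ' : γ' ∉ XPrime ξ) (hne : γ ≠ γ') :
    omegaCode ξ 3 γ ≠ omegaCode ξ 3 γ' := by
  intro hω
  obtain ⟨M, hM⟩ := exists_isAdicOrbit hγ
  obtain ⟨M', hM'⟩ := exists_isAdicOrbit hγ'
  have h3 : ∀ t, ∀ i < 3, adicIter ξ t γ i = adicIter ξ t γ' i := fun t i hi => by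
    have := congrFun hω t
    simp only [omegaCode, List.map_inj_left, List.mem_range] at this
    exact this i hi
  have key : ∀ n, 3 ≤ n → ∀ t, ∀ i < n, adicIter ξ t γ i = adicIter ξ t γ' i := by
    intro n hn
    induction n, hn using Nat.le_induction with
    | base => exact h3
    | succ n hn ih =>
      intro t i hi
      rcases Nat.lt_succ_iff_lt_or_eq.mp hi with hi | rfl
      · exact ih t i hi
      · exact hM.edge_eq_of_lt_eq hn hM' ih t
  exact hne (funext fun i => key (i + 3) (by omega) 0 i (by omega))
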